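/- arXiv:1109.6172 — 3 statements merged into one kernel-verified Lean document; each statement's English description precedes it below -/
import Mathlib

section
/- Let r ≥ 0 and let V = {(x, y, z) ∈ ℕ³ : x + y + z = r − 1} (interpreted as empty when r = 0). Define three linear orders on V: (x₁,y₁,z₁) < (x₂,y₂,z₂) in π₁ iff x₁ < x₂, or (x₁ = x₂ and y₁ < y₂); in π₂ iff y₁ < y₂, or (y₁ = y₂ and z₁ < z₂); in π₃ iff z₁ < z₂, or (z₁ = z₂ and x₁ < x₂). Let G_r be the 3-majority tournament of {π₁, π₂, π₃} on V. Then every acyclic set of vertices of G_r has at most r vertices; equivalently, every transitive sub-tournament of G_r has at most r vertices. -/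
/-- First lexicographic order `π₁` on triples: compare `x`, then `y`. -/
def pi1 (a b : ℕ × ℕ × ℕ) : Prop :=
  a.1 < b.1 ∨ (a.1 = b.1 ∧ a.2.1 < b.2.1)

/-- Second lexicographic order `π₂` on triples: compare `y`, then `z`. -/
def pi2 (a b : ℕ × ℕ × ℕ) : Prop :=
  a.2.1 < b.2.1 ∨ (a.2.1 = b.2.1 ∧ a.2.2 < b.2.2)

/-- Third lexicographic order `π₃` on triples: compare `z`, then `x`. -/
def pi3 (a b : ℕ × ℕ × ℕ) : Prop :=
  a.2.2 < b.2.2 ∨ (a.2.2 = b.2.2 ∧ a.1 < b.1)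

/-- Edge relation of the 3-majority digraph of three orders `p, q, s`:
there is an edge `u → v` iff `u` precedes `v` in at least 2 of the three orders. -/
def majEdge3 {V : Type*} (p q s : V → V → Prop) (u v : V) : Prop :=
  (p u v ∧ q u v) ∨ (p u v ∧ s u v) ∨ (q u v ∧ s u v)

/-- A set `S` of vertices of the digraph with edge relation `E` is acyclic if
the induced subdigraph contains no directed cycle (equivalently, no closed
directed walk lies entirely inside `S`). -/
def AcyclicOn {V : Type*} (E : V → V → Prop) (S : Set V) : Prop :=
  ¬ ∃ (n : ℕ) (f : Fin (n + 1) → V), (∀ i, f i ∈ S) ∧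
      (∀ i : Fin n, E (f i.castSucc) (f i.succ)) ∧ E (f (Fin.last n)) (f 0)

theorem aux_walk {V : Type*} (E : V → V → Prop) (S : Set V) (a b : S)
    (h : Relation.TransGen (fun u v : S => E u.1 v.1) a b) :
    ∃ (n : ℕ) (f : Fin (n + 1) → V), (∀ i, f i ∈ S) ∧
      (∀ i : Fin n, E (f i.castSucc) (f i.succ)) ∧ f 0 = a.1 ∧ E (f (Fin.last n)) b.1 := by
  induction h with
  | single h => exact ⟨0, fun _ => a.1, fun _ => a.2, fun i => i.elim0, rfl, h⟩
  | @tail b c _ hbc ih =>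
    obtain ⟨n, f, h1, h2, h3, h4⟩ := ih
    refine ⟨n + 1, Fin.snoc (α := fun _ => V) f b.1, ?_, ?_, ?_, ?_⟩
    · intro i
      refine Fin.lastCases ?_ (fun j => ?_) i
      · simp
      · simpa using h1 j
    · intro i
      refine Fin.lastCases ?_ (fun j => ?_) i
      · simpa using h4
      · rw [Fin.succ_castSucc, Fin.snoc_castSucc, Fin.snoc_castSucc]
        exact h2 j
    · have : (0 : Fin (n + 1 + 1)) = Fin.castSucc 0 := rfl
      rw [this, Fin.snoc_castSucc]
      exact h3
    · simpa using hbc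

theorem aux_source {V : Type*} (E : V → V → Prop) (S : Set V) (hS : AcyclicOn E S)
    (hf : S.Finite) (T : Set V) (hT : T ⊆ S) (hne : T.Nonempty) :
    ∃ v ∈ T, ∀ w ∈ T, ¬ E w v := by
  have : Finite S := hf
  let R : S → S → Prop := Relation.TransGen (fun u v : S => E u.1 v.1)
  have hirr : Std.Irrefl R := ⟨fun a h => by
    obtain ⟨n, f, h1, h2, h3, h4⟩ := aux_walk E S a a h
    exact hS ⟨n, f, h1, h2, h3 ▸ h4⟩⟩
  have htr : IsTrans S R := ⟨fun a b c h h' => Relation.TransGen.trans h h'⟩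
  have wf : WellFounded R := Finite.wellFounded_of_trans_of_irrefl R
  obtain ⟨t, ht⟩ := hne
  obtain ⟨m, hm, hmin⟩ := wf.has_min {x : S | x.1 ∈ T} ⟨⟨t, hT ht⟩, ht⟩
  exact ⟨m.1, hm, fun w hw h => hmin ⟨w, hT hw⟩ hw (Relation.TransGen.single h)⟩

theorem aux_main (m : ℕ) : ∀ (a b c : ℕ) (T : Finset (ℕ × ℕ × ℕ)),
    (∀ p ∈ T, a ≤ p.1 ∧ b ≤ p.2.1 ∧ c ≤ p.2.2 ∧ p.1 + p.2.1 + p.2.2 + 1 = a + b + c + m) →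
    (∀ T' ⊆ T, T'.Nonempty → ∃ v ∈ T', ∀ w ∈ T', ¬ majEdge3 pi1 pi2 pi3 w v) →
    T.card ≤ m := by
  induction m using Nat.strong_induction_on with
  | _ m ih =>
  intro a b c T hT hsrc
  rcases T.eq_empty_or_nonempty with rfl | hne
  · simp
  obtain ⟨⟨x, y, z⟩, hv, hmin⟩ := hsrc T (Finset.Subset.refl _) hne
  have hv' := hT _ hv
  simp only at hv'
  let A := T.filter (fun p => x ≤ p.1 ∧ y + 1 ≤ p.2.1)
  let B := T.filter (fun p => x + 1 ≤ p.1 ∧ z ≤ p.2.2)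
  let C := T.filter (fun p => y ≤ p.2.1 ∧ z + 1 ≤ p.2.2)
  have hsub : T ⊆ insert (x, y, z) (A ∪ (B ∪ C)) := by
    rintro ⟨p, q, s⟩ hp
    have h1 := hT _ hp
    have h2 := hmin _ hp
    simp only [majEdge3, pi1, pi2, pi3] at h1 h2
    simp only [A, B, C, Finset.mem_insert, Finset.mem_union, Finset.mem_filter, hp, true_and,
      Prod.mk.injEq]
    omega
  have hA : A.card ≤ z - c := by
    refine ih (z - c) (by omega) x (y + 1) c A ?_
      (fun T' h => hsrc T' (h.trans (Finset.filter_subset _ _)))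
    intro p hp
    simp only [A, Finset.mem_filter] at hp
    have := hT p hp.1
    omega
  have hB : B.card ≤ y - b := by
    refine ih (y - b) (by omega) (x + 1) b z B ?_
      (fun T' h => hsrc T' (h.trans (Finset.filter_subset _ _)))
    intro p hp
    simp only [B, Finset.mem_filter] at hp
    have := hT p hp.1
    omega
  have hC : C.card ≤ x - a := by
    refine ih (x - a) (by omega) a y (z + 1) C ?_
      (fun T' h => hsrc T' (h.trans (Finset.filter_subset _ _)))
    intro p hp
    simp only [C, Finset.mem_filter] at hp
    have := hT p hp.1
    omega
  have e1 := Finset.card_le_card hsub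
  have e2 := Finset.card_insert_le (x, y, z) (A ∪ (B ∪ C))
  have e3 := Finset.card_union_le A (B ∪ C)
  have e4 := Finset.card_union_le B C
  omega

/-- For `r ≥ 0`, on `V = {(x,y,z) ∈ ℕ³ : x + y + z = r - 1}`
(encoded as `x + y + z + 1 = r`, so `V` is empty when `r = 0`), every acyclic
set of vertices of the 3-majority tournament `G_r` of `π₁, π₂, π₃` has at most
`r` vertices. -/
theorem acyclic_set_le (r : ℕ)
    (S : Set {p : ℕ × ℕ × ℕ // p.1 + p.2.1 + p.2.2 + 1 = r})
    (hS : AcyclicOn (majEdge3 (fun u v => pi1 u.1 v.1) (fun u v => pi2 u.1 v.1)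
      (fun u v => pi3 u.1 v.1)) S) :
    S.ncard ≤ r := by
  by_cases hf : S.Finite
  swap
  · rw [Set.Infinite.ncard hf]; omega
  rw [Set.ncard_eq_toFinset_card S hf,
    ← Finset.card_map (Function.Embedding.subtype _)]
  apply aux_main r 0 0 0
  · intro p hp
    simp only [Finset.mem_map] at hp
    obtain ⟨q, -, rfl⟩ := hp
    have := q.2
    simp only [Function.Embedding.subtype_apply]
    omega
  · intro T' hT' ⟨t, ht⟩
    have key : ∀ p ∈ T', ∃ q ∈ S, q.1 = p := by
      intro p hp
      have := hT' hp
      simp only [Finset.mem_map, Set.Finite.mem_toFinset] at this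
      exact this
    obtain ⟨q, hq, hqt⟩ := key t ht
    obtain ⟨v, hv, hmin⟩ := aux_source _ S hS hf {q | q ∈ S ∧ q.1 ∈ T'} (fun q h => h.1)
      ⟨q, hq, hqt ▸ ht⟩
    refine ⟨v.1, hv.2, fun w hw h => ?_⟩
    obtain ⟨u, hu, rfl⟩ := key w hw
    exact hmin u ⟨hu, hw⟩ h
end

section
/- For every integer r ≥ 0 and n = r(r+1)/2, there exist three linear orders π₁, π₂, π₃ on an n-element set V such that every acyclic set of vertices in the 3-majority tournament of {π₁, π₂, π₃} has at most r vertices. In other words, if n = r(r+1)/2 for some integer r, then f₃(n) ≤ r, where f₃(n) is the minimum, over all 3-majority tournaments T with n vertices, of the maximum size of an acyclic vertex set in T. -/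
theorem f3aux_sto {V : Type*} (a b : V → ℤ)
    (hinj : ∀ u v, a u = a v → b u = b v → u = v) :
    IsStrictTotalOrder V (fun u v => a u < a v ∨ (a u = a v ∧ b u < b v)) where
  irrefl u h := by omega
  trans u v w h1 h2 := by omega
  trichotomous u v h1 h2 := hinj u v (by omega) (by omega)

def f3auxE {V : Type*} (a b c : V → ℤ) (u v : V) : Prop :=
  (a u ≤ a v ∧ b u < b v) ∨ (b u ≤ b v ∧ c u < c v) ∨ (c u ≤ c v ∧ a u < a v)

theorem f3aux_source {V : Type*} [DecidableEq V] (E : V → V → Prop) (S : Finset V)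
    (htot : ∀ u v, u ≠ v → E u v ∨ E v u)
    (htr : ∀ u ∈ S, ∀ v ∈ S, ∀ w ∈ S, E u v → E v w → E u w) :
    ∀ T : Finset V, T ⊆ S → T.Nonempty → ∃ x ∈ T, ∀ y ∈ T, y ≠ x → E x y := by
  intro T
  induction T using Finset.induction_on with
  | empty => intro _ h; simp at h
  | insert y T hy ih =>
    intro hs _
    have hyS : y ∈ S := hs (Finset.mem_insert_self _ _)
    have hTS : T ⊆ S := fun z hz => hs (Finset.mem_insert_of_mem hz)
    rcases T.eq_empty_or_nonempty with rfl | hne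
    · exact ⟨y, by simp, by simp⟩
    obtain ⟨x, hx, hxs⟩ := ih hTS hne
    have hxy : x ≠ y := fun h => hy (h ▸ hx)
    rcases htot x y hxy with h | h
    · refine ⟨x, Finset.mem_insert_of_mem hx, fun z hz hzx => ?_⟩
      rcases Finset.mem_insert.1 hz with rfl | hz
      · exact h
      · exact hxs z hz hzx
    · refine ⟨y, Finset.mem_insert_self _ _, fun z hz hzy => ?_⟩
      rcases Finset.mem_insert.1 hz with rfl | hz
      · exact absurd rfl hzy
      · by_cases hzx : z = x
        · exact hzx ▸ h
        · exact htr y hyS x (hTS hx) z (hTS hz) h (hxs z hz hzx)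

theorem f3aux_bound {V : Type*} [DecidableEq V] (a b c : V → ℤ) (N : ℤ)
    (hsum : ∀ v, a v + b v + c v = N) (n : ℕ) :
    ∀ (S : Finset V), S.card ≤ n →
      (∀ T : Finset V, T ⊆ S → T.Nonempty → ∃ x ∈ T, ∀ y ∈ T, y ≠ x → f3auxE a b c x y) →
      ∀ α β γ : ℤ, (∀ v ∈ S, α ≤ a v ∧ β ≤ b v ∧ γ ≤ c v) → α + β + γ ≤ N + 1 →
      (S.card : ℤ) ≤ 1 + N - α - β - γ := by
  induction n with
  | zero => intro S hS _ α β γ _ h; omega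
  | succ n ih =>
    intro S hS hsrc α β γ hb hN
    rcases S.eq_empty_or_nonempty with rfl | hne
    · simp; omega
    obtain ⟨x, hx, hxs⟩ := hsrc S (Finset.Subset.refl _) hne
    have hsx := hsum x
    have hbx := hb x hx
    have key : ∀ (p : V → Prop) [DecidablePred p], ¬ p x → ∀ α β γ : ℤ,
        (∀ v ∈ S, p v → α ≤ a v ∧ β ≤ b v ∧ γ ≤ c v) → α + β + γ ≤ N + 1 →
        ((S.filter p).card : ℤ) ≤ 1 + N - α - β - γ := by
      intro p _ hp α β γ h1 h2
      refine ih _ ?_ ?_ α β γ ?_ h2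
      · have : (S.filter p).card < S.card :=
          Finset.card_lt_card (Finset.filter_ssubset.2 ⟨x, hx, hp⟩)
        omega
      · exact fun T hT => hsrc T (hT.trans (Finset.filter_subset _ _))
      · intro v hv
        rw [Finset.mem_filter] at hv
        exact h1 v hv.1 hv.2
    have kA := key (fun u => b x ≤ b u ∧ c x < c u) (by simp) α (b x) (c x + 1)
      (fun v hv h => ⟨(hb v hv).1, h.1, h.2⟩) (by omega)
    have kB := key (fun u => c x ≤ c u ∧ a x < a u) (by simp) (a x + 1) β (c x)
      (fun v hv h => ⟨h.2, (hb v hv).2.1, h.1⟩) (by omega)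
    have kC := key (fun u => a x ≤ a u ∧ b x < b u) (by simp) (a x) (b x + 1) γ
      (fun v hv h => ⟨h.1, h.2, (hb v hv).2.2⟩) (by omega)
    have hcov : S ⊆ ({x} ∪ S.filter (fun u => b x ≤ b u ∧ c x < c u)) ∪
        (S.filter (fun u => c x ≤ c u ∧ a x < a u) ∪
          S.filter (fun u => a x ≤ a u ∧ b x < b u)) := by
      intro y hy
      simp only [Finset.mem_union, Finset.mem_filter, Finset.mem_singleton]
      by_cases hyx : y = x
      · tauto
      · rcases hxs y hy hyx with h | h | h <;> tauto
    have h1 := Finset.card_le_card hcov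
    have h2 := Finset.card_union_le ({x} ∪ S.filter (fun u => b x ≤ b u ∧ c x < c u))
      (S.filter (fun u => c x ≤ c u ∧ a x < a u) ∪ S.filter (fun u => a x ≤ a u ∧ b x < b u))
    have h3 := Finset.card_union_le {x} (S.filter (fun u => b x ≤ b u ∧ c x < c u))
    have h4 := Finset.card_union_le (S.filter (fun u => c x ≤ c u ∧ a x < a u))
      (S.filter (fun u => a x ≤ a u ∧ b x < b u))
    rw [Finset.card_singleton] at h3
    omega

theorem f3_triangular_le (r : ℕ) (V : Type*) [Fintype V]
    (hV : Fintype.card V = r * (r + 1) / 2) :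
    ∃ p1 p2 p3 : V → V → Prop,
      IsStrictTotalOrder V p1 ∧ IsStrictTotalOrder V p2 ∧ IsStrictTotalOrder V p3 ∧
      ∀ S : Set V, AcyclicOn (majEdge3 p1 p2 p3) S → S.ncard ≤ r := by
  classical
  have hcard : Fintype.card V = Fintype.card (Σ i : Fin r, Fin (i.val + 1)) := by
    rw [hV, Fintype.card_sigma]
    simp only [Fintype.card_fin]
    rw [Fin.sum_univ_eq_sum_range (fun i => i + 1) r]
    have h := Finset.sum_range_id (r + 1)
    rw [Finset.sum_range_succ'] at h
    simp only [add_zero, Nat.add_sub_cancel] at h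
    rw [h, mul_comm]
  let e := Fintype.equivOfCardEq hcard
  obtain ⟨a, b, c, hsum, hinj, hnn⟩ : ∃ a b c : V → ℤ,
      (∀ v, a v + b v + c v = (r : ℤ) - 1) ∧ (∀ u v, a u = a v → b u = b v → u = v) ∧
      (∀ v, 0 ≤ a v ∧ 0 ≤ b v ∧ 0 ≤ c v) := by
    refine ⟨fun v => ((e v).2.val : ℤ), fun v => ((e v).1.val : ℤ) - ((e v).2.val : ℤ),
      fun v => (r : ℤ) - 1 - ((e v).1.val : ℤ), ?_, ?_, ?_⟩
    · intro v; ring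
    · intro u v h1 h2
      apply e.injective
      simp only at h1 h2
      generalize e u = x at h1 h2 ⊢
      generalize e v = y at h1 h2 ⊢
      obtain ⟨⟨i, hi⟩, ⟨j, hj⟩⟩ := x
      obtain ⟨⟨i', hi'⟩, ⟨j', hj'⟩⟩ := y
      simp only at h1 h2
      obtain rfl : j = j' := by omega
      obtain rfl : i = i' := by omega
      rfl
    · intro v
      have h1 := (e v).1.2
      have h2 := (e v).2.2
      refine ⟨?_, ?_, ?_⟩ <;> simp only <;> omega
  refine ⟨_, _, _, f3aux_sto a b hinj,
    f3aux_sto b c (fun u v h1 h2 => hinj u v (by have := hsum u; have := hsum v; omega) h1),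
    f3aux_sto c a (fun u v h1 h2 => hinj u v h2 (by have := hsum u; have := hsum v; omega)), ?_⟩
  intro S hS
  have hE : ∀ u v, f3auxE a b c u v → majEdge3
      (fun u v => a u < a v ∨ (a u = a v ∧ b u < b v))
      (fun u v => b u < b v ∨ (b u = b v ∧ c u < c v))
      (fun u v => c u < c v ∨ (c u = c v ∧ a u < a v)) u v := by
    intro u v h
    have := hsum u
    have := hsum v
    unfold f3auxE at h
    unfold majEdge3
    omega
  have htot : ∀ u v, u ≠ v → f3auxE a b c u v ∨ f3auxE a b c v u := by
    intro u v huv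
    have h1 := hsum u
    have h2 := hsum v
    have h3 : ¬ (a u = a v ∧ b u = b v) := fun h => huv (hinj u v h.1 h.2)
    unfold f3auxE
    omega
  have htr : ∀ u ∈ S.toFinset, ∀ v ∈ S.toFinset, ∀ w ∈ S.toFinset,
      f3auxE a b c u v → f3auxE a b c v w → f3auxE a b c u w := by
    intro u hu v hv w hw h1 h2
    rw [Set.mem_toFinset] at hu hv hw
    by_cases huw : u = w
    · subst huw
      have := hsum u
      have := hsum v
      unfold f3auxE at *
      omega
    rcases htot u w huw with h | h
    · exact h
    · exfalso
      apply hS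
      refine ⟨2, ![u, v, w], ?_, ?_, ?_⟩
      · intro i; fin_cases i <;> assumption
      · intro i; fin_cases i
        · exact hE u v h1
        · exact hE v w h2
      · exact hE w u h
  have := f3aux_bound a b c _ hsum _ S.toFinset le_rfl
    (f3aux_source _ _ htot htr) 0 0 0 (fun v _ => hnn v) (by omega)
  rw [Set.ncard_eq_toFinset_card']
  omega
end

section
/- For every positive integer n, there exist three linear orders π₁, π₂, π₃ on an n-element set V such that every acyclic set of vertices in the 3-majority tournament of {π₁, π₂, π₃} has fewer than √(2n) + 1/2 vertices. In other words, f₃(n) < √(2n) + 1/2, where f₃(n) is the minimum, over all 3-majority tournaments T with n vertices, of the maximum size of an acyclic vertex set in T. -/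
def lexO {V : Type*} (x y : V → ℤ) (u v : V) : Prop :=
  x u < x v ∨ (x u = x v ∧ y u < y v)

def triE {V : Type*} (x y z : V → ℤ) (u v : V) : Prop :=
  majEdge3 (lexO x y) (lexO y z) (lexO z x) u v

theorem triE_rot {V : Type*} {x y z : V → ℤ} {u v : V} (h : triE x y z u v) :
    triE y z x u v := by
  unfold triE majEdge3 at *
  tauto

theorem lexO_sto {V : Type*} (x y : V → ℤ)
    (hinj : ∀ u v, x u = x v → y u = y v → u = v) : IsStrictTotalOrder V (lexO x y) where
  trichotomous u v h1 h2 := by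
    unfold lexO at h1 h2
    apply hinj <;> omega
  irrefl u h := by unfold lexO at h; omega
  trans u v w h1 h2 := by unfold lexO at *; omega

theorem exists_source {V : Type*} [DecidableEq V] (E : V → V → Prop)
    (htot : ∀ u v, u ≠ v → E u v ∨ E v u) (S : Finset V) (hS : S.Nonempty)
    (h3 : ∀ a ∈ S, ∀ b ∈ S, ∀ c ∈ S, ¬ (E a b ∧ E b c ∧ E c a)) :
    ∃ s ∈ S, ∀ u ∈ S, u ≠ s → E s u := by
  induction hS using Finset.Nonempty.cons_induction with
  | singleton a => exact ⟨a, by simp, by simp⟩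
  | cons a S ha hS ih =>
    obtain ⟨s, hs, hsu⟩ := ih (fun a ha b hb c hc => h3 a (by simp [ha]) b (by simp [hb]) c (by simp [hc]))
    have hne : s ≠ a := fun h => ha (h ▸ hs)
    rcases htot s a hne with h | h
    · refine ⟨s, by simp [hs], fun u hu hus => ?_⟩
      rcases Finset.mem_cons.1 hu with rfl | hu
      · exact h
      · exact hsu u hu hus
    · refine ⟨a, by simp, fun u hu hua => ?_⟩
      rcases Finset.mem_cons.1 hu with rfl | hu
      · exact absurd rfl hua
      · by_cases hus : u = s
        · exact hus ▸ h
        · rcases htot a u (Ne.symm hua) with h' | h'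
          · exact h'
          · exact absurd ⟨h, hsu u hu hus, h'⟩
              (h3 a (by simp) s (by simp [hs]) u (by simp [hu]))

theorem case_lemma {V : Type*} [DecidableEq V] (x y z : V → ℤ) (N : ℤ)
    (hsum : ∀ v, x v + y v + z v = N) (S : Finset V) (s : V) (hs : s ∈ S)
    (hsrc : ∀ u ∈ S, u ≠ s → triE x y z s u)
    (IH : ∀ T ⊂ S, T.Nonempty → ∀ a b c, (∀ v ∈ T, a ≤ x v) → (∀ v ∈ T, b ≤ y v) →
      (∀ v ∈ T, c ≤ z v) → (T.card : ℤ) ≤ 1 + N - a - b - c)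
    (hno : ¬ ∃ p ∈ S, p ≠ s ∧ y p = y s ∧ x p < x s)
    (a b c : ℤ) (ha : ∀ v ∈ S, a ≤ x v) (hb : ∀ v ∈ S, b ≤ y v) (hc : ∀ v ∈ S, c ≤ z v) :
    (S.card : ℤ) ≤ 1 + N - a - b - c := by
  push Not at hno
  set S' := S.erase s with hS'
  have hcard : S'.card + 1 = S.card := Finset.card_erase_add_one hs
  have hsub : S' ⊂ S := Finset.erase_ssubset hs
  have hsplit := Finset.card_filter_add_card_filter_not (s := S') (fun v => y v ≤ y s)
  set C := S'.filter (fun v => y v ≤ y s) with hC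
  set B := S'.filter (fun v => ¬ y v ≤ y s) with hB
  have h1 : (C.card : ℤ) ≤ y s - b := by
    rcases C.eq_empty_or_nonempty with h | h
    · rw [h]; have := hb s hs; simp; omega
    · have key : ∀ v ∈ C, x s + 1 ≤ x v ∧ z s ≤ z v := by
        intro v hv
        simp only [hC, hS', Finset.mem_filter, Finset.mem_erase] at hv
        have e := hsrc v hv.1.2 hv.1.1
        have n := hno v hv.1.2 hv.1.1
        have := hsum v
        have := hsum s
        unfold triE majEdge3 lexO at e
        omega
      have := IH C (lt_of_le_of_lt (Finset.filter_subset _ _) hsub) h (x s + 1) b (z s)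
        (fun v hv => (key v hv).1)
        (fun v hv => hb v (Finset.mem_of_mem_erase (Finset.mem_filter.1 hv).1))
        (fun v hv => (key v hv).2)
      have := hsum s
      omega
  have h2 : (B.card : ℤ) ≤ N - a - y s - c := by
    rcases B.eq_empty_or_nonempty with h | h
    · rw [h]
      have := ha s hs
      have := hc s hs
      have := hsum s
      simp; omega
    · have := IH B (lt_of_le_of_lt (Finset.filter_subset _ _) hsub) h a (y s + 1) c
        (fun v hv => ha v (Finset.mem_of_mem_erase (Finset.mem_filter.1 hv).1))
        (fun v hv => by have := (Finset.mem_filter.1 hv).2; omega)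
        (fun v hv => hc v (Finset.mem_of_mem_erase (Finset.mem_filter.1 hv).1))
      omega
  omega

theorem tri_bound {V : Type*} [DecidableEq V] (x y z : V → ℤ) (N : ℤ)
    (hsum : ∀ v, x v + y v + z v = N)
    (hinj : ∀ u v, x u = x v → y u = y v → u = v) (S : Finset V)
    (h3 : ∀ a ∈ S, ∀ b ∈ S, ∀ c ∈ S,
      ¬ (triE x y z a b ∧ triE x y z b c ∧ triE x y z c a)) :
    S.Nonempty → ∀ a b c, (∀ v ∈ S, a ≤ x v) → (∀ v ∈ S, b ≤ y v) →
      (∀ v ∈ S, c ≤ z v) → (S.card : ℤ) ≤ 1 + N - a - b - c := by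
  induction S using Finset.strongInduction with
  | H S ih =>
  intro hS a b c ha hb hc
  have IH : ∀ T ⊂ S, T.Nonempty → ∀ a b c, (∀ v ∈ T, a ≤ x v) → (∀ v ∈ T, b ≤ y v) →
      (∀ v ∈ T, c ≤ z v) → (T.card : ℤ) ≤ 1 + N - a - b - c := fun T hT =>
    ih T hT (fun a ha b hb c hc => h3 a (hT.1 ha) b (hT.1 hb) c (hT.1 hc))
  have htot : ∀ u v, u ≠ v → triE x y z u v ∨ triE x y z v u := by
    intro u v huv
    by_contra hcon
    apply huv
    have := hsum u
    have := hsum v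
    unfold triE majEdge3 lexO at hcon
    apply hinj <;> omega
  obtain ⟨s, hs, hsrc⟩ := exists_source _ htot S hS h3
  by_cases n1 : ∃ p ∈ S, p ≠ s ∧ y p = y s ∧ x p < x s
  · by_cases n2 : ∃ p ∈ S, p ≠ s ∧ z p = z s ∧ y p < y s
    · by_cases n3 : ∃ p ∈ S, p ≠ s ∧ x p = x s ∧ z p < z s
      · obtain ⟨p, hp, -, hp1, hp2⟩ := n1
        obtain ⟨q, hq, -, hq1, hq2⟩ := n2
        obtain ⟨r, hr, -, hr1, hr2⟩ := n3
        exfalso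
        have := hsum s
        have := hsum p
        have := hsum q
        have := hsum r
        refine h3 p hp r hr q hq ⟨?_, ?_, ?_⟩ <;> unfold triE majEdge3 lexO <;> omega
      · have := case_lemma z x y N (fun v => by have := hsum v; omega) S s hs
          (fun u hu h => triE_rot (triE_rot (hsrc u hu h)))
          (fun T hT hn a b c h1 h2 h3 => by have := IH T hT hn b c a h2 h3 h1; omega)
          n3 c a b hc ha hb
        omega
    · have := case_lemma y z x N (fun v => by have := hsum v; omega) S s hs
          (fun u hu h => triE_rot (hsrc u hu h))
          (fun T hT hn a b c h1 h2 h3 => by have := IH T hT hn c a b h3 h1 h2; omega)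
          n2 b c a hb hc ha
      omega
  · exact case_lemma x y z N hsum S s hs hsrc IH n1 a b c ha hb hc

theorem card_tri (N : ℕ) : Fintype.card (Σ k : Fin (N + 1), Fin (k.1 + 1)) * 2 = (N + 1) * (N + 2) := by
  rw [Fintype.card_sigma]
  simp only [Fintype.card_fin]
  rw [Fin.sum_univ_eq_sum_range (fun k => k + 1) (N + 1)]
  induction N with
  | zero => simp
  | succ n ih => rw [Finset.sum_range_succ, add_mul, ih]; ring

/-- For every positive integer `n` and every `n`-element set `V`,
there exist three linear (strict total) orders `π₁, π₂, π₃` on `V` such that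
every acyclic set of vertices in their 3-majority tournament has fewer than
`√(2n) + 1/2` vertices; i.e. `f₃(n) < √(2n) + 1/2`. -/
theorem f3_lt_sqrt (n : ℕ) (hn : 0 < n) (V : Type*) [Fintype V]
    (hV : Fintype.card V = n) :
    ∃ p1 p2 p3 : V → V → Prop,
      IsStrictTotalOrder V p1 ∧ IsStrictTotalOrder V p2 ∧ IsStrictTotalOrder V p3 ∧
      ∀ S : Set V, AcyclicOn (majEdge3 p1 p2 p3) S →
        (S.ncard : ℝ) < Real.sqrt (2 * n) + 1 / 2 := by
  classical
  have hex : ∃ N : ℕ, 2 * n ≤ (N + 1) * (N + 2) := ⟨n, by nlinarith⟩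
  obtain ⟨N, hN1, hN2⟩ : ∃ N : ℕ, 2 * n ≤ (N + 1) * (N + 2) ∧ N * (N + 1) < 2 * n := by
    refine ⟨Nat.find hex, Nat.find_spec hex, ?_⟩
    rcases h : Nat.find hex with _ | m
    · simpa using hn
    · have := Nat.find_min hex (m := m) (by omega)
      have e : (m + 1) * (m + 1 + 1) = (m + 1) * (m + 2) := by ring
      omega
  obtain ⟨g⟩ := Function.Embedding.nonempty_of_card_le
    (α := V) (β := Σ k : Fin (N + 1), Fin (k.1 + 1)) (by have := card_tri N; omega)
  set x : V → ℤ := fun v => ((g v).2.1 : ℤ) with hx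
  set y : V → ℤ := fun v => ((g v).1.1 : ℤ) - ((g v).2.1 : ℤ) with hy
  set z : V → ℤ := fun v => (N : ℤ) - ((g v).1.1 : ℤ) with hz
  have hsum : ∀ v, x v + y v + z v = N := fun v => by simp only [hx, hy, hz]; ring
  have hinj : ∀ u v, x u = x v → y u = y v → u = v := by
    intro u v h1 h2
    apply g.injective
    simp only [hx, hy] at h1 h2
    generalize g u = p at *
    generalize g v = q at *
    obtain ⟨⟨k, hk⟩, ⟨i, hi⟩⟩ := p
    obtain ⟨⟨k', hk'⟩, ⟨i', hi'⟩⟩ := q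
    simp only at h1 h2
    obtain rfl : k = k' := by omega
    obtain rfl : i = i' := by omega
    rfl
  refine ⟨lexO x y, lexO y z, lexO z x, lexO_sto x y hinj,
    lexO_sto y z fun u v h1 h2 => hinj u v ?_ h1,
    lexO_sto z x fun u v h1 h2 => hinj u v h2 ?_, ?_⟩
  · have := hsum u; have := hsum v; omega
  · have := hsum u; have := hsum v; omega
  intro S hS
  have hb : S.ncard ≤ N + 1 := by
    rw [Set.ncard_eq_toFinset_card']
    rcases S.toFinset.eq_empty_or_nonempty with h | h
    · rw [h]; simp
    · have := tri_bound x y z N hsum hinj S.toFinset (by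
        intro a ha b hb c hc ⟨e1, e2, e3⟩
        simp only [Set.mem_toFinset] at ha hb hc
        apply hS
        refine ⟨2, ![a, b, c], ?_, ?_, ?_⟩
        · intro i; fin_cases i <;> assumption
        · intro i; fin_cases i <;> assumption
        · exact e3) h 0 0 0
        (fun v _ => by simp only [hx]; omega)
        (fun v _ => by have := (g v).2.2; simp only [hy]; omega)
        (fun v _ => by have := (g v).1.2; simp only [hz]; omega)
      omega
  have hb' : (S.ncard : ℝ) ≤ N + 1 := by exact_mod_cast hb
  have h4 : ((N : ℝ) * (N + 1) + 1) ≤ 2 * n := by exact_mod_cast hN2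
  have : (N : ℝ) + 1 / 2 < Real.sqrt (2 * n) := by
    apply Real.lt_sqrt_of_sq_lt
    nlinarith
  linarith
end
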